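/- Let q₁, q₂ ∈ ℂ and q = q₁ + q₂·j, and suppose that the polynomial D_q is not a nonzero constant (that is, D_q is identically zero or D_q has at least one complex root). Then q belongs to P(ℍ∖ℝ) ∪ P∨(ℍ∖ℝ) ∪ P_ℝ(𝕊×ℝ). In particular, if for every q ∈ ℍ the polynomial D_q is identically zero or nonconstant, then P(ℍ∖ℝ) ∪ P∨(ℍ∖ℝ) ∪ P_ℝ(𝕊×ℝ) = ℍ (a Fundamental Theorem of Algebra for slice-polynomial functions). -/

import Mathlib

/-- The quaternion imaginary unit `i`. -/
noncomputable def qi : Quaternion ℝ := ⟨0, 1, 0, 0⟩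

/-- The quaternion imaginary unit `j`. -/
noncomputable def qj : Quaternion ℝ := ⟨0, 0, 1, 0⟩

/-- Identification of ℂ with the slice ℂ_i of the quaternions. -/
noncomputable def cq (z : ℂ) : Quaternion ℝ := ⟨z.re, z.im, 0, 0⟩

/-- The slice-polynomial function associated with `g, h, g', h'` at `α + βI` (`β > 0`). -/
noncomputable def Pslice (g h g' h' : Polynomial ℂ) (α β : ℝ) (I : Quaternion ℝ) : Quaternion ℝ :=
  ((1 - I * qi) / 2) * (cq (g.eval ⟨α, β⟩) + cq (h.eval ⟨α, β⟩) * qj) +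
  ((1 + I * qi) / 2) *
    (cq ((starRingEnd ℂ) (g'.eval ⟨α, β⟩)) + cq ((starRingEnd ℂ) (h'.eval ⟨α, β⟩)) * qj)

/-- The companion slice-polynomial function at `α + βI` (`β > 0`), using `v̄ = α - iβ`. -/
noncomputable def Pveeslice (g h g' h' : Polynomial ℂ) (α β : ℝ) (I : Quaternion ℝ) :
    Quaternion ℝ :=
  ((1 - I * qi) / 2) *
    (cq ((starRingEnd ℂ) (g'.eval ⟨α, -β⟩)) + cq ((starRingEnd ℂ) (h'.eval ⟨α, -β⟩)) * qj) +
  ((1 + I * qi) / 2) * (cq (g.eval ⟨α, -β⟩) + cq (h.eval ⟨α, -β⟩) * qj)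

/-- The extension to the real line of the slice-polynomial function. -/
noncomputable def PRext (g h g' h' : Polynomial ℂ) (I : Quaternion ℝ) (α : ℝ) : Quaternion ℝ :=
  ((1 - I * qi) / 2) * (cq (g.eval (α : ℂ)) + cq (h.eval (α : ℂ)) * qj) +
  ((1 + I * qi) / 2) *
    (cq ((starRingEnd ℂ) (g'.eval (α : ℂ))) + cq ((starRingEnd ℂ) (h'.eval (α : ℂ))) * qj)

@[simp] theorem qi_re : qi.re = 0 := rfl
@[simp] theorem qi_imI : qi.imI = 1 := rfl
@[simp] theorem qi_imJ : qi.imJ = 0 := rfl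
@[simp] theorem qi_imK : qi.imK = 0 := rfl

@[simp] theorem qj_re : qj.re = 0 := rfl
@[simp] theorem qj_imI : qj.imI = 0 := rfl
@[simp] theorem qj_imJ : qj.imJ = 1 := rfl
@[simp] theorem qj_imK : qj.imK = 0 := rfl

@[simp] theorem cq_re (z : ℂ) : (cq z).re = z.re := rfl
@[simp] theorem cq_imI (z : ℂ) : (cq z).imI = z.im := rfl
@[simp] theorem cq_imJ (z : ℂ) : (cq z).imJ = 0 := rfl
@[simp] theorem cq_imK (z : ℂ) : (cq z).imK = 0 := rfl

theorem Quaternion.mul_self_eq_neg_one {I : Quaternion ℝ} (hre : I.re = 0)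
    (hnorm : Quaternion.normSq I = 1) : I * I = -1 := by
  have hstar : star I = -I := by
    ext <;> simp [hre]
  have h := Quaternion.self_mul_star I
  rw [hstar, hnorm, mul_neg] at h
  rw [← neg_neg (I * I), h, Quaternion.coe_one]

theorem normSq_qi : Quaternion.normSq qi = 1 := by
  simp [Quaternion.normSq_def']

theorem qi_mul_self : qi * qi = -1 :=
  Quaternion.mul_self_eq_neg_one qi_re normSq_qi

/-- If `A * star B` lies in `ℂ j`, then some imaginary unit `I` satisfies `I i (A - B) = A + B`. -/
theorem exists_unit_mul_sub_eq_add (A B : Quaternion ℝ) (hre : (A * star B).re = 0)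
    (him : (A * star B).imI = 0) :
    ∃ I : Quaternion ℝ, I * I = -1 ∧ I * qi * (A - B) = A + B := by
  by_cases hAB : A = B
  · subst hAB
    rw [Quaternion.self_mul_star, Quaternion.re_coe, Quaternion.normSq_eq_zero] at hre
    exact ⟨qi, qi_mul_self, by simp [hre]⟩
  · have hne : A - B ≠ 0 := sub_ne_zero.mpr hAB
    have hnorm : Quaternion.normSq (A + B) = Quaternion.normSq (A - B) := by
      simp only [Quaternion.normSq_def', Quaternion.re_mul, Quaternion.re_star,
        Quaternion.imI_star, Quaternion.imJ_star, Quaternion.imK_star, Quaternion.re_add,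
        Quaternion.imI_add, Quaternion.imJ_add, Quaternion.imK_add, Quaternion.re_sub,
        Quaternion.imI_sub, Quaternion.imJ_sub, Quaternion.imK_sub] at hre ⊢
      linear_combination 4 * hre
    refine ⟨-((A + B) * (A - B)⁻¹ * qi), Quaternion.mul_self_eq_neg_one ?_ ?_, ?_⟩
    · have hN : ((A + B) * star (A - B)).imI = 0 := by
        simp only [Quaternion.imI_mul, Quaternion.re_star,
          Quaternion.imI_star, Quaternion.imJ_star, Quaternion.imK_star, Quaternion.re_add,
          Quaternion.imI_add, Quaternion.imJ_add, Quaternion.imK_add, Quaternion.re_sub,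
          Quaternion.imI_sub, Quaternion.imJ_sub, Quaternion.imK_sub] at him ⊢
        linear_combination (-2) * him
      rw [Quaternion.inv_def, mul_smul_comm, smul_mul_assoc, Quaternion.re_neg,
        Quaternion.re_smul, Quaternion.re_mul _ qi, hN]
      simp
    · rw [Quaternion.normSq_neg, map_mul, map_mul, normSq_qi, hnorm, Quaternion.normSq_inv,
        mul_one, mul_inv_cancel₀ (Quaternion.normSq_ne_zero.mpr hne)]
    · rw [neg_mul, mul_assoc _ qi qi, qi_mul_self, mul_neg_one, neg_neg, mul_assoc,
        inv_mul_cancel₀ hne, mul_one]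

theorem exists_unit_slice_combination_eq {a b c d q₁ q₂ : ℂ}
    (h : (a - q₁) * (starRingEnd ℂ) (c - q₁) + (b - q₂) * (starRingEnd ℂ) (d - q₂) = 0) :
    ∃ I : Quaternion ℝ, I * I = -1 ∧
      ((1 - I * qi) / 2) * (cq a + cq b * qj) + ((1 + I * qi) / 2) * (cq c + cq d * qj) =
        cq q₁ + cq q₂ * qj := by
  have hre := congrArg Complex.re h
  have him := congrArg Complex.im h
  simp only [Complex.add_re, Complex.mul_re, Complex.sub_re, Complex.sub_im, Complex.conj_re,
    Complex.conj_im, Complex.add_im, Complex.mul_im, Complex.zero_re, Complex.zero_im]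
    at hre him
  obtain ⟨I, hI, hmul⟩ := exists_unit_mul_sub_eq_add
    (cq a + cq b * qj - (cq q₁ + cq q₂ * qj)) (cq c + cq d * qj - (cq q₁ + cq q₂ * qj))
    (by simp; linear_combination hre) (by simp; linear_combination him)
  refine ⟨I, hI, ?_⟩
  generalize cq a + cq b * qj = X at *
  generalize cq c + cq d * qj = Y at *
  generalize cq q₁ + cq q₂ * qj = Q at *
  generalize I * qi = W at *
  have hdiv (x : Quaternion ℝ) : x / 2 = (2⁻¹ : ℝ) • x := by
    have h2 : (2 : Quaternion ℝ) = ((2 : ℝ) : Quaternion ℝ) := rfl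
    rw [div_eq_mul_inv, h2, ← Quaternion.coe_inv, Quaternion.mul_coe_eq_smul]
  have hsum : (1 - W) * X + (1 + W) * Y = (2 : ℝ) • Q := by
    rw [two_smul]
    have hW : W * X - W * Y = X + Y - Q - Q := by
      rw [← mul_sub, ← sub_sub_sub_cancel_right X Y Q, hmul]
      abel
    calc (1 - W) * X + (1 + W) * Y = X + Y - (W * X - W * Y) := by noncomm_ring
      _ = Q + Q := by rw [hW]; abel
  rw [hdiv, hdiv, smul_mul_assoc, smul_mul_assoc, ← smul_add, hsum, smul_smul]
  norm_num

/-- A Fundamental Theorem of Algebra for slice-polynomial functions: if `D_q` is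
identically zero or has a complex root, then `q = q₁ + q₂ j` lies in
`P(ℍ∖ℝ) ∪ P∨(ℍ∖ℝ) ∪ P_ℝ(𝕊×ℝ)`. -/
theorem mem_union_images (g h g' h' : Polynomial ℂ) (q₁ q₂ : ℂ)
    (Dq : Polynomial ℂ)
    (hDq : Dq = -((g - Polynomial.C q₁) * (Polynomial.C ((starRingEnd ℂ) q₁) - g')) +
      (h - Polynomial.C q₂) * (h' - Polynomial.C ((starRingEnd ℂ) q₂)))
    (hyp : Dq = 0 ∨ ∃ v : ℂ, Dq.eval v = 0) :
    (∃ (α β : ℝ) (I : Quaternion ℝ), 0 < β ∧ I * I = -1 ∧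
        Pslice g h g' h' α β I = cq q₁ + cq q₂ * qj) ∨
    (∃ (α β : ℝ) (I : Quaternion ℝ), 0 < β ∧ I * I = -1 ∧
        Pveeslice g h g' h' α β I = cq q₁ + cq q₂ * qj) ∨
    (∃ (I : Quaternion ℝ) (α : ℝ), I * I = -1 ∧
        PRext g h g' h' I α = cq q₁ + cq q₂ * qj) := by
  obtain ⟨v, hv⟩ : ∃ v : ℂ, Dq.eval v = 0 := by
    rcases hyp with h0 | hv
    · exact ⟨0, by simp [h0]⟩
    · exact hv
  have key : (g.eval v - q₁) * (starRingEnd ℂ) ((starRingEnd ℂ) (g'.eval v) - q₁) +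
      (h.eval v - q₂) * (starRingEnd ℂ) ((starRingEnd ℂ) (h'.eval v) - q₂) = 0 := by
    simp only [hDq, Polynomial.eval_add, Polynomial.eval_neg, Polynomial.eval_mul,
      Polynomial.eval_sub, Polynomial.eval_C] at hv
    simp only [map_sub, Complex.conj_conj]
    linear_combination hv
  rcases lt_trichotomy v.im 0 with hneg | hzero | hpos
  · have key' := congrArg (starRingEnd ℂ) key
    simp only [map_add, map_mul, Complex.conj_conj, map_zero] at key'
    obtain ⟨I, hI, hq⟩ := exists_unit_slice_combination_eq
      (a := (starRingEnd ℂ) (g'.eval v)) (b := (starRingEnd ℂ) (h'.eval v))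
      (c := g.eval v) (d := h.eval v) (q₁ := q₁) (q₂ := q₂) (by linear_combination key')
    refine Or.inr (Or.inl ⟨v.re, -v.im, I, neg_pos.mpr hneg, hI, ?_⟩)
    rw [Pveeslice, neg_neg]
    exact hq
  · obtain ⟨I, hI, hq⟩ := exists_unit_slice_combination_eq key
    refine Or.inr (Or.inr ⟨I, v.re, hI, ?_⟩)
    have hv' : (v.re : ℂ) = v := Complex.ext rfl hzero.symm
    rw [PRext, hv']
    exact hq
  · obtain ⟨I, hI, hq⟩ := exists_unit_slice_combination_eq key
    exact Or.inl ⟨v.re, v.im, I, hpos, hI, hq⟩
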